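/- Let T = ⟨𝒜, 𝒲, d⟩ be a tag system with all words ω_i nonempty, ω a nonempty word over 𝒜, and P₀ a finite set of formulas in which the variable x⁰ does not occur, such that every formula derivable in Int_{→} is derivable from P₀. Then the following are equivalent: (i) T halts on the input word ω; (ii) every formula derivable from P₀ is derivable from P_{T,ω,P₀}; (iii) P₀ and P_{T,ω,P₀} derive exactly the same formulas. -/

import Mathlib

/-- Propositional formulas over the signature {→}. -/
inductive Fm : Type
  | var : ℕ → Fm
  | imp : Fm → Fm → Fm
  deriving DecidableEq

/-- Apply a substitution (uniform replacement of variables by formulas). -/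
def Fm.subst (σ : ℕ → Fm) : Fm → Fm
  | var n => σ n
  | imp A B => imp (A.subst σ) (B.subst σ)

/-- Derivability from a set of axioms by modus ponens and substitution. -/
inductive Deriv (P : Set Fm) : Fm → Prop
  | ax {A : Fm} : A ∈ P → Deriv P A
  | mp {A B : Fm} : Deriv P A → Deriv P (A.imp B) → Deriv P B
  | subst (σ : ℕ → Fm) {A : Fm} : Deriv P A → Deriv P (A.subst σ)

/-- The fixed variable x⁰. -/
def x0 : Fm := Fm.var 0

/-- Axioms of the intuitionistic implicational calculus Int_{→}:
A1: x → (y → x), A2: (x → (y → z)) → ((x → y) → (x → z)). -/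
def IntAx : Set Fm :=
  { Fm.imp (Fm.var 0) (Fm.imp (Fm.var 1) (Fm.var 0)),
    Fm.imp (Fm.imp (Fm.var 0) (Fm.imp (Fm.var 1) (Fm.var 2)))
      (Fm.imp (Fm.imp (Fm.var 0) (Fm.var 1)) (Fm.imp (Fm.var 0) (Fm.var 2))) }

/-- A ∨ B abbreviates (A → B) → B. -/
def orF (A B : Fm) : Fm := (A.imp B).imp B

/-- E 0 = x⁰ → x⁰ (i.e. E_1), E (k+1) = E k → x⁰. -/
def E : ℕ → Fm
  | 0 => x0.imp x0
  | n + 1 => (E n).imp x0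

/-- The code of the letter a_i (letters are elements of `Fin m`). -/
def code {m : ℕ} (i : Fin m) : Fm := (E i.val).imp (x0.imp (x0.imp x0))

/-- The formula ▷ = ((x⁰ → x⁰) → x⁰) → x⁰. -/
def tri : Fm := ((x0.imp x0).imp x0).imp x0

/-- Right-nested disjunction of a nonempty list of formulas. -/
def rlist : List Fm → Fm
  | [] => x0
  | [A] => A
  | A :: B :: Bs => orF A (rlist (B :: Bs))

def llistAux : Fm → List Fm → Fm
  | A, [] => A
  | A, B :: Bs => llistAux (orF A B) Bs

/-- Left-nested disjunction of a nonempty list of formulas. -/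
def llist : List Fm → Fm
  | [] => x0
  | A :: As => llistAux A As

/-- \overrightarrow{α}: right-nested disjunction of codes of the letters of α. -/
def rword {m : ℕ} (w : List (Fin m)) : Fm := rlist (w.map code)

/-- \overleftarrow{α}: left-nested disjunction of codes of the letters of α. -/
def lword {m : ℕ} (w : List (Fin m)) : Fm := llist (w.map code)

/-- A substitution instance of a member of M. -/
def SubStar (M : Set Fm) : Set Fm := {F | ∃ A ∈ M, ∃ σ : ℕ → Fm, F = Fm.subst σ A}

/-- Two formulas are unifiable if they have a common substitution instance. -/
def Unifiable (A B : Fm) : Prop := ∃ σ τ : ℕ → Fm, Fm.subst σ A = Fm.subst τ B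

/-- The variable v occurs in a formula. -/
def Occurs (v : ℕ) : Fm → Prop
  | Fm.var w => v = w
  | Fm.imp A B => Occurs v A ∨ Occurs v B

/-- Alphabetic formulas (𝒜-formulas) over the alphabet `Fin m`. -/
inductive AForm (m : ℕ) : Fm → Prop
  | ofCode (i : Fin m) : AForm m (code i)
  | ofOr {A B : Fm} : AForm m A → AForm m B → AForm m (orF A B)

/-- A tag system ⟨𝒜, 𝒲, d⟩ with 𝒜 = Fin m. -/
structure TagSystem where
  m : ℕ
  W : Fin m → List (Fin m)
  d : ℕ

/-- One production step of the tag system: a_i β γ ↦ γ ω_i, |β| = d - 1. -/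
def TagStep (T : TagSystem) (ξ ζ : List (Fin T.m)) : Prop :=
  ∃ (i : Fin T.m) (β γ : List (Fin T.m)),
    β.length = T.d - 1 ∧ ξ = i :: (β ++ γ) ∧ ζ = γ ++ T.W i

/-- ⟹_T : reflexive–transitive closure of the one-step production. -/
def TagSteps (T : TagSystem) : List (Fin T.m) → List (Fin T.m) → Prop :=
  Relation.ReflTransGen (TagStep T)

/-- T halts on α: α produces some word shorter than d. -/
def Halts (T : TagSystem) (α : List (Fin T.m)) : Prop :=
  ∃ β, TagSteps T α β ∧ β.length < T.d

/-- Axioms R1: (▷ → (y ∨ \overrightarrow{az}) ∨ u) → (▷ → (\overleftarrow{ya} ∨ z) ∨ u),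
with y = var 1, z = var 2, u = var 3. -/
def R1Ax (m : ℕ) : Set Fm :=
  {F | ∃ a : Fin m, F =
    (tri.imp (orF (orF (Fm.var 1) (orF (code a) (Fm.var 2))) (Fm.var 3))).imp
      (tri.imp (orF (orF (orF (Fm.var 1) (code a)) (Fm.var 2)) (Fm.var 3)))}

/-- Axioms R2: (▷ → \overleftarrow{ya} ∨ z) → (▷ → y ∨ \overrightarrow{az}). -/
def R2Ax (m : ℕ) : Set Fm :=
  {F | ∃ a : Fin m, F =
    (tri.imp (orF (orF (Fm.var 1) (code a)) (Fm.var 2))).imp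
      (tri.imp (orF (Fm.var 1) (orF (code a) (Fm.var 2))))}

/-- Axioms T1: (▷ → \overrightarrow{a_i α y}) → (▷ → \overrightarrow{y ω_i}), |α| = d - 1. -/
def T1Ax (T : TagSystem) : Set Fm :=
  {F | ∃ (i : Fin T.m) (α : List (Fin T.m)), α.length = T.d - 1 ∧
    F = (tri.imp (rlist (((i :: α).map code) ++ [Fm.var 1]))).imp
      (tri.imp (rlist (Fm.var 1 :: (T.W i).map code)))}

/-- Axioms T2: (▷ → \overrightarrow{a_i α}) → (▷ → \overrightarrow{ω_i}), |α| = d - 1. -/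
def T2Ax (T : TagSystem) : Set Fm :=
  {F | ∃ (i : Fin T.m) (α : List (Fin T.m)), α.length = T.d - 1 ∧
    F = (tri.imp (rword (i :: α))).imp (tri.imp (rword (T.W i)))}

/-- P_T = T1 ∪ T2 ∪ R1 ∪ R2. -/
def PT (T : TagSystem) : Set Fm := T1Ax T ∪ T2Ax T ∪ R1Ax T.m ∪ R2Ax T.m

/-- Axioms H: (▷ → \overrightarrow{α}) → A for 0 < |α| < d and A ∈ P₀. -/
def HAx (T : TagSystem) (P₀ : Finset Fm) : Set Fm :=
  {F | ∃ (α : List (Fin T.m)) (A : Fm), 0 < α.length ∧ α.length < T.d ∧ A ∈ P₀ ∧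
    F = (tri.imp (rword α)).imp A}

/-- P_{T,P₀} = P_T ∪ H. -/
def PTP (T : TagSystem) (P₀ : Finset Fm) : Set Fm := PT T ∪ HAx T P₀

/-- The calculus P_{T,ω,P₀} = {W_ω} ∪ P_T ∪ H. -/
def PTot (T : TagSystem) (ω : List (Fin T.m)) (P₀ : Finset Fm) : Set Fm :=
  insert (tri.imp (rword ω)) (PTP T P₀)

/-- Code(α): the four types of codes of a nonempty word α. -/
def CodeSet {m : ℕ} (α : List (Fin m)) : Set Fm :=
  {F | F = tri.imp (rword α)} ∪
  {F | ∃ α₁ α₂ : List (Fin m), α = α₁ ++ α₂ ∧ 2 ≤ α₁.length ∧ 1 ≤ α₂.length ∧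
    F = tri.imp (orF (rword α₁) (rword α₂))} ∪
  {F | ∃ α₁ α₂ α₃ : List (Fin m), α = α₁ ++ α₂ ++ α₃ ∧
    2 ≤ α₁.length ∧ 2 ≤ α₂.length ∧ 1 ≤ α₃.length ∧
    F = tri.imp (orF (orF (lword α₁) (rword α₂)) (rword α₃))} ∪
  {F | ∃ α₁ α₂ : List (Fin m), α = α₁ ++ α₂ ∧ 3 ≤ α₁.length ∧ 1 ≤ α₂.length ∧
    F = tri.imp (orF (lword α₁) (rword α₂))}

/-- Code_T(ω)*: substitution instances of codes of words produced from ω by T. -/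
def CodeTStar (T : TagSystem) (ω : List (Fin T.m)) : Set Fm :=
  {F | ∃ β, TagSteps T ω β ∧ F ∈ SubStar (CodeSet β)}

/-- ⟨P⟩: one application of modus ponens or substitution to members of P. -/
def StepSet (P : Set Fm) : Set Fm :=
  {B | ∃ A, A ∈ P ∧ A.imp B ∈ P} ∪ {B | ∃ A ∈ P, ∃ σ : ℕ → Fm, B = Fm.subst σ A}

/-- ⟨P⟩_n. -/
def Stages (P : Set Fm) : ℕ → Set Fm
  | 0 => P
  | n + 1 => StepSet (Stages P n)


/-! Helper notions: everything with `x⁰` replaced by a formula `s`. -/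

def ES (s : Fm) : ℕ → Fm
  | 0 => s.imp s
  | n + 1 => (ES s n).imp s

def codeS (s : Fm) {m : ℕ} (i : Fin m) : Fm := (ES s i.val).imp (s.imp (s.imp s))

def triS (s : Fm) : Fm := ((s.imp s).imp s).imp s

def Fm.sz : Fm → ℕ
  | var _ => 1
  | imp A B => A.sz + B.sz + 1

theorem Fm.sz_pos (A : Fm) : 0 < A.sz := by
  cases A <;> simp [Fm.sz]

theorem E_subst (σ : ℕ → Fm) (n : ℕ) : (E n).subst σ = ES (σ 0) n := by
  induction n with
  | zero => rfl
  | succ n ih => simp [E, ES, Fm.subst, ih, x0]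

theorem code_subst (σ : ℕ → Fm) {m : ℕ} (i : Fin m) :
    (code i).subst σ = codeS (σ 0) i := by
  simp [code, codeS, Fm.subst, E_subst, x0]

theorem tri_subst (σ : ℕ → Fm) : tri.subst σ = triS (σ 0) := rfl

theorem ES_x0 (n : ℕ) : ES (Fm.var 0) n = E n := by
  induction n with
  | zero => rfl
  | succ n ih => simp [E, ES, ih, x0]

theorem codeS_x0 {m : ℕ} (i : Fin m) : codeS (Fm.var 0) i = code i := by
  simp [code, codeS, ES_x0, x0]

theorem triS_x0 : triS (Fm.var 0) = tri := rfl

theorem ES_subst (σ : ℕ → Fm) (s : Fm) (n : ℕ) : (ES s n).subst σ = ES (s.subst σ) n := by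
  induction n with
  | zero => rfl
  | succ n ih => simp [ES, Fm.subst, ih]

theorem codeS_subst (σ : ℕ → Fm) (s : Fm) {m : ℕ} (i : Fin m) :
    (codeS s i).subst σ = codeS (s.subst σ) i := by
  simp [codeS, Fm.subst, ES_subst]

theorem orF_subst (σ : ℕ → Fm) (A B : Fm) :
    (orF A B).subst σ = orF (A.subst σ) (B.subst σ) := rfl

theorem rlist_subst (σ : ℕ → Fm) (l : List Fm) (h : l ≠ []) :
    (rlist l).subst σ = rlist (l.map (Fm.subst σ)) := by
  induction l with
  | nil => exact absurd rfl h
  | cons A l ih =>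
    cases l with
    | nil => rfl
    | cons B l =>
      have ih' := ih (by simp)
      simp only [rlist, orF_subst, List.map_cons] at ih' ⊢
      rw [ih']

theorem rlist_cons (A : Fm) (l : List Fm) (h : l ≠ []) :
    rlist (A :: l) = orF A (rlist l) := by
  cases l with
  | nil => exact absurd rfl h
  | cons B l => rfl

theorem rlist_append (l r : List Fm) (h : r ≠ []) :
    rlist (l ++ [rlist r]) = rlist (l ++ r) := by
  induction l with
  | nil => rfl
  | cons A l ih =>
    rw [List.cons_append, List.cons_append, rlist_cons _ _ (by simp),
      rlist_cons _ _ (by simp [h]), ih]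

theorem map_code_subst (σ : ℕ → Fm) {m : ℕ} (l : List (Fin m)) :
    (l.map code).map (Fm.subst σ) = l.map (codeS (σ 0)) := by
  simp [code_subst]

theorem rword_subst (σ : ℕ → Fm) {m : ℕ} (l : List (Fin m)) (h : l ≠ []) :
    (rword l).subst σ = rlist (l.map (codeS (σ 0))) := by
  rw [rword, rlist_subst _ _ (by simpa using h), map_code_subst]

/-- `X` is an alphabetic formula (at `s`) with letters `β` read from left to right. -/
inductive Fl {m : ℕ} (s : Fm) : List (Fin m) → Fm → Prop
  | letter (i : Fin m) : Fl s [i] (codeS s i)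
  | disj {α β : List (Fin m)} {A B : Fm} :
      Fl s α A → Fl s β B → Fl s (α ++ β) (orF A B)

theorem Fl.subst (σ : ℕ → Fm) {m : ℕ} {s : Fm} {β : List (Fin m)} {X : Fm}
    (h : Fl s β X) : Fl (s.subst σ) β (X.subst σ) := by
  induction h with
  | letter i => rw [codeS_subst]; exact .letter i
  | disj _ _ ih1 ih2 => exact .disj ih1 ih2

theorem codeS_ne_orF {m : ℕ} (s : Fm) (i : Fin m) (A B : Fm) : codeS s i ≠ orF A B := by
  intro h
  simp only [codeS, orF, Fm.imp.injEq] at h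
  obtain ⟨h1, rfl⟩ := h
  cases hn : i.val with
  | zero =>
    rw [hn] at h1
    simp only [ES, Fm.imp.injEq] at h1
    have := congrArg Fm.sz h1.2
    simp only [Fm.sz] at this
    omega
  | succ n =>
    rw [hn] at h1
    simp only [ES, Fm.imp.injEq] at h1
    have := congrArg Fm.sz h1.2
    simp only [Fm.sz] at this
    omega

theorem ES_sz (s : Fm) (n : ℕ) : (ES s n).sz = (n + 1) * (s.sz + 1) + s.sz := by
  induction n with
  | zero => simp [ES, Fm.sz]; ring
  | succ n ih => simp [ES, Fm.sz, ih]; ring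

theorem codeS_inj {m : ℕ} {s : Fm} {i j : Fin m} (h : codeS s i = codeS s j) : i = j := by
  simp only [codeS, Fm.imp.injEq, and_true] at h
  have := congrArg Fm.sz h
  rw [ES_sz, ES_sz] at this
  have h2 := Nat.add_right_cancel this
  have h3 := Nat.eq_of_mul_eq_mul_right (Nat.succ_pos _) h2
  exact Fin.ext (by omega)

theorem Fl.or_inv {m : ℕ} {s : Fm} {β : List (Fin m)} {A B : Fm} (h : Fl s β (orF A B)) :
    ∃ β₁ β₂, β = β₁ ++ β₂ ∧ Fl s β₁ A ∧ Fl s β₂ B := by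
  generalize hX : orF A B = X at h
  cases h with
  | letter i => exact absurd hX.symm (codeS_ne_orF s i A B)
  | disj h1 h2 =>
    simp only [orF, Fm.imp.injEq] at hX
    obtain ⟨⟨rfl, rfl⟩, -⟩ := hX
    exact ⟨_, _, rfl, h1, h2⟩

theorem Fl.code_inv {m : ℕ} {s : Fm} {β : List (Fin m)} {i : Fin m}
    (h : Fl s β (codeS s i)) : β = [i] := by
  generalize hX : codeS s i = X at h
  cases h with
  | letter j => rw [codeS_inj hX]
  | disj h1 h2 => exact absurd hX (codeS_ne_orF s i _ _)

theorem Fl.rlist_mk {m : ℕ} (s : Fm) (l : List (Fin m)) (h : l ≠ []) :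
    Fl s l (rlist (l.map (codeS s))) := by
  induction l with
  | nil => exact absurd rfl h
  | cons a l ih =>
    cases l with
    | nil => exact .letter a
    | cons b l => exact .disj (.letter a) (ih (by simp))

theorem Fl.rlist_append_inv {m : ℕ} {s : Fm} (l : List (Fin m)) {Y : Fm} :
    ∀ {β : List (Fin m)}, Fl s β (rlist (l.map (codeS s) ++ [Y])) →
      ∃ γ, β = l ++ γ ∧ Fl s γ Y := by
  induction l with
  | nil => intro β h; exact ⟨β, rfl, h⟩
  | cons a l ih =>
    intro β h
    rw [List.map_cons, List.cons_append, rlist_cons _ _ (by simp)] at h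
    obtain ⟨β₁, β₂, rfl, h1, h2⟩ := h.or_inv
    obtain ⟨γ, rfl, h3⟩ := ih h2
    rw [h1.code_inv]
    exact ⟨γ, rfl, h3⟩

theorem Fl.rlist_inv {m : ℕ} {s : Fm} (l : List (Fin m)) (hl : l ≠ []) :
    ∀ {β : List (Fin m)}, Fl s β (rlist (l.map (codeS s))) → β = l := by
  induction l with
  | nil => exact absurd rfl hl
  | cons a l ih =>
    intro β h
    cases l with
    | nil => exact h.code_inv
    | cons b l =>
      rw [List.map_cons, rlist_cons _ _ (by simp)] at h
      obtain ⟨β₁, β₂, rfl, h1, h2⟩ := h.or_inv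
      rw [h1.code_inv, ih (by simp) h2]
      rfl

theorem triS_inj {s t : Fm} (h : triS s = triS t) : s = t := by
  simp only [triS, Fm.imp.injEq] at h
  exact h.2

theorem triS_ne_a (s t : Fm) : triS t ≠ (s.imp s).imp s := by
  intro h
  simp only [triS, Fm.imp.injEq] at h
  obtain ⟨⟨h1, h2⟩, rfl⟩ := h
  have := congrArg Fm.sz h1
  simp only [Fm.sz] at this
  omega

theorem triS_ne_b (s t : Fm) : triS t ≠ s.imp s := by
  intro h
  simp only [triS, Fm.imp.injEq] at h
  obtain ⟨h1, rfl⟩ := h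
  have := congrArg Fm.sz h1
  simp only [Fm.sz] at this
  omega

theorem PTP_shape (T : TagSystem) (P₀ : Finset Fm) {A : Fm} (hA : A ∈ PTP T P₀)
    (σ : ℕ → Fm) : ∃ Y Z, A.subst σ = ((triS (σ 0)).imp Y).imp Z := by
  rcases hA with (((h | h) | h) | h) | h
  · obtain ⟨i, α, -, rfl⟩ := h
    exact ⟨_, _, rfl⟩
  · obtain ⟨i, α, -, rfl⟩ := h
    exact ⟨_, _, rfl⟩
  · obtain ⟨a, rfl⟩ := h
    exact ⟨_, _, rfl⟩
  · obtain ⟨a, rfl⟩ := h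
    exact ⟨_, _, rfl⟩
  · obtain ⟨α, A, -, -, -, rfl⟩ := h
    exact ⟨_, _, rfl⟩

/-- The invariant of derivations. -/
def GoodCode (T : TagSystem) (ω : List (Fin T.m)) (F : Fm) : Prop :=
  ∃ s β X, TagSteps T ω β ∧ Fl s β X ∧ F = (triS s).imp X

theorem PTP_step (T : TagSystem) (hW : ∀ i, T.W i ≠ []) (ω : List (Fin T.m))
    (P₀ : Finset Fm) (hn : ¬ Halts T ω)
    {A : Fm} (hA : A ∈ PTP T P₀) (σ : ℕ → Fm) {s X B : Fm} {β : List (Fin T.m)}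
    (hβ : TagSteps T ω β) (hX : Fl s β X)
    (h : ((triS s).imp X).imp B = A.subst σ) : GoodCode T ω B := by
  rcases hA with (((hA | hA) | hA) | hA) | hA
  · obtain ⟨i, α, hα, rfl⟩ := hA
    simp only [Fm.subst, tri_subst, Fm.imp.injEq] at h
    obtain ⟨⟨h1, rfl⟩, rfl⟩ := h
    obtain rfl := triS_inj h1
    rw [rlist_subst _ _ (by simp), List.map_append, map_code_subst] at hX
    obtain ⟨γ, rfl, hY⟩ := Fl.rlist_append_inv _ hX
    refine ⟨_, γ ++ T.W i, _, hβ.tail ⟨i, α, γ, hα, rfl, rfl⟩, ?_, rfl⟩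
    rw [rlist_subst _ _ (by simp), List.map_cons, map_code_subst,
      rlist_cons _ _ (by simpa using hW i)]
    exact .disj hY (Fl.rlist_mk _ _ (hW i))
  · obtain ⟨i, α, hα, rfl⟩ := hA
    simp only [Fm.subst, tri_subst, Fm.imp.injEq] at h
    obtain ⟨⟨h1, rfl⟩, rfl⟩ := h
    obtain rfl := triS_inj h1
    rw [rword_subst _ _ (by simp)] at hX
    obtain rfl := Fl.rlist_inv _ (by simp) hX
    refine ⟨_, T.W i, _, hβ.tail ⟨i, α, [], hα, by simp, rfl⟩, ?_, rfl⟩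
    rw [rword_subst _ _ (hW i)]
    exact Fl.rlist_mk _ _ (hW i)
  · obtain ⟨a, rfl⟩ := hA
    simp only [Fm.subst, tri_subst, orF_subst, code_subst, Fm.imp.injEq] at h
    obtain ⟨⟨h1, rfl⟩, rfl⟩ := h
    obtain rfl := triS_inj h1
    obtain ⟨b1, b2, rfl, h2, h3⟩ := hX.or_inv
    obtain ⟨b3, b4, rfl, h4, h5⟩ := h2.or_inv
    obtain ⟨b5, b6, rfl, h6, h7⟩ := h5.or_inv
    refine ⟨_, _, _, hβ, ?_, rfl⟩
    have := Fl.disj (Fl.disj (Fl.disj h4 h6) h7) h3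
    simpa only [List.append_assoc] using this
  · obtain ⟨a, rfl⟩ := hA
    simp only [Fm.subst, tri_subst, orF_subst, code_subst, Fm.imp.injEq] at h
    obtain ⟨⟨h1, rfl⟩, rfl⟩ := h
    obtain rfl := triS_inj h1
    obtain ⟨b1, b2, rfl, h2, h3⟩ := hX.or_inv
    obtain ⟨b3, b4, rfl, h4, h5⟩ := h2.or_inv
    refine ⟨_, _, _, hβ, ?_, rfl⟩
    have := Fl.disj h4 (Fl.disj h5 h3)
    simpa only [List.append_assoc] using this
  · obtain ⟨α, A, hα, hαd, -, rfl⟩ := hA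
    simp only [Fm.subst, tri_subst, Fm.imp.injEq] at h
    obtain ⟨⟨h1, rfl⟩, rfl⟩ := h
    obtain rfl := triS_inj h1
    have hne : α ≠ [] := List.length_pos_iff.1 hα
    rw [rword_subst _ _ hne] at hX
    obtain rfl := Fl.rlist_inv _ hne hX
    exact absurd ⟨_, hβ, hαd⟩ hn

theorem Fm.subst_subst (σ τ : ℕ → Fm) (A : Fm) :
    (A.subst σ).subst τ = A.subst (fun n => (σ n).subst τ) := by
  induction A with
  | var n => rfl
  | imp A B ih1 ih2 => simp [Fm.subst, ih1, ih2]

theorem Fm.subst_var (A : Fm) : A.subst Fm.var = A := by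
  induction A with
  | var n => rfl
  | imp A B ih1 ih2 => simp [Fm.subst, ih1, ih2]

theorem good_of_deriv (T : TagSystem) (hW : ∀ i, T.W i ≠ []) (ω : List (Fin T.m))
    (hω : ω ≠ []) (P₀ : Finset Fm) (hn : ¬ Halts T ω) {F : Fm}
    (hF : Deriv (PTot T ω P₀) F) :
    GoodCode T ω F ∨ ∃ A ∈ PTP T P₀, ∃ σ : ℕ → Fm, F = A.subst σ := by
  induction hF with
  | ax h =>
    rcases h with rfl | h
    · left
      refine ⟨Fm.var 0, ω, _, .refl, ?_, rfl⟩
      rw [← Fm.subst_var (rword ω), rword_subst _ _ hω]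
      exact Fl.rlist_mk _ _ hω
    · exact Or.inr ⟨_, h, Fm.var, (Fm.subst_var _).symm⟩
  | subst τ _ ih =>
    rcases ih with ⟨s, β, X, h1, h2, rfl⟩ | ⟨A, hA, σ, rfl⟩
    · exact Or.inl ⟨s.subst τ, β, X.subst τ, h1, h2.subst τ, rfl⟩
    · exact Or.inr ⟨A, hA, _, Fm.subst_subst _ _ _⟩
  | mp _ _ ih1 ih2 =>
    left
    rcases ih2 with ⟨s, β, X, h1, h2, h3⟩ | ⟨A, hA, σ, h3⟩
    · exfalso
      simp only [Fm.imp.injEq] at h3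
      obtain ⟨rfl, rfl⟩ := h3
      rcases ih1 with ⟨t, β', X', -, -, h⟩ | ⟨A, hA, σ, h⟩
      · have h' : ((s.imp s).imp s).imp s = (triS t).imp X' := h
        exact triS_ne_a _ _ (Fm.imp.inj h').1.symm
      · obtain ⟨Y, Z, hs⟩ := PTP_shape T P₀ hA σ
        rw [hs] at h
        rw [triS] at h
        simp only [Fm.imp.injEq] at h
        exact triS_ne_b _ _ h.1.1.symm
    · rcases ih1 with ⟨t, β', X', h1, h2, rfl⟩ | ⟨A', hA', τ, rfl⟩
      · exact PTP_step T hW ω P₀ hn hA σ h1 h2 h3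
      · exfalso
        obtain ⟨Y, Z, hs⟩ := PTP_shape T P₀ hA σ
        obtain ⟨Y', Z', hs'⟩ := PTP_shape T P₀ hA' τ
        rw [hs, hs'] at h3
        have h4 := h3
        simp only [Fm.imp.injEq] at h4
        have h5 := h4.1.1
        conv at h5 => rhs; rw [triS]
        simp only [Fm.imp.injEq] at h5
        exact triS_ne_a _ _ h5.1

theorem not_good_id (T : TagSystem) (ω : List (Fin T.m)) (P₀ : Finset Fm) :
    ¬ (GoodCode T ω ((Fm.var 1).imp (Fm.var 1)) ∨
      ∃ A ∈ PTP T P₀, ∃ σ : ℕ → Fm, (Fm.var 1).imp (Fm.var 1) = A.subst σ) := by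
  rintro (⟨s, β, X, -, -, h⟩ | ⟨A, hA, σ, h⟩)
  · simp [triS] at h
  · obtain ⟨Y, Z, hs⟩ := PTP_shape T P₀ hA σ
    rw [hs] at h
    simp at h

/-! Implicational intuitionistic reasoning. -/

theorem int_K (A B : Fm) : Deriv IntAx (A.imp (B.imp A)) :=
  Deriv.subst (fun n => if n = 0 then A else B)
    (A := Fm.imp (Fm.var 0) (Fm.imp (Fm.var 1) (Fm.var 0))) (Deriv.ax (Or.inl rfl))

theorem int_S (A B C : Fm) :
    Deriv IntAx ((A.imp (B.imp C)).imp ((A.imp B).imp (A.imp C))) :=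
  Deriv.subst (fun n => if n = 0 then A else if n = 1 then B else C)
    (A := Fm.imp (Fm.imp (Fm.var 0) (Fm.imp (Fm.var 1) (Fm.var 2)))
      (Fm.imp (Fm.imp (Fm.var 0) (Fm.var 1)) (Fm.imp (Fm.var 0) (Fm.var 2))))
    (Deriv.ax (Or.inr rfl))

theorem int_I (A : Fm) : Deriv IntAx (A.imp A) :=
  Deriv.mp (int_K A A) (Deriv.mp (int_K A (A.imp A)) (int_S A (A.imp A) A))

theorem int_weaken {A : Fm} (B : Fm) (h : Deriv IntAx A) : Deriv IntAx (B.imp A) :=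
  Deriv.mp h (int_K A B)

theorem int_or1 {A : Fm} (B : Fm) (h : Deriv IntAx A) : Deriv IntAx (orF A B) :=
  Deriv.mp (int_weaken (A.imp B) h) (Deriv.mp (int_I (A.imp B)) (int_S (A.imp B) A B))

theorem int_or2 (A : Fm) {B : Fm} (h : Deriv IntAx B) : Deriv IntAx (orF A B) :=
  int_weaken _ h

theorem int_code {m : ℕ} (i : Fin m) : Deriv IntAx (code i) :=
  int_weaken _ (int_K _ _)

theorem int_rword {m : ℕ} (w : List (Fin m)) (h : w ≠ []) : Deriv IntAx (rword w) := by
  cases w with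
  | nil => exact absurd rfl h
  | cons a w =>
    cases w with
    | nil => exact int_code a
    | cons b w => exact int_or1 _ (int_code a)

theorem PTot_le (T : TagSystem) (hW : ∀ i, T.W i ≠ []) (ω : List (Fin T.m)) (hω : ω ≠ [])
    (P₀ : Finset Fm) (hInt : ∀ A : Fm, Deriv IntAx A → Deriv (↑P₀) A) {F : Fm}
    (hF : Deriv (PTot T ω P₀) F) : Deriv (↑P₀) F := by
  induction hF with
  | mp _ _ ih1 ih2 => exact ih1.mp ih2
  | subst σ _ ih => exact ih.subst σ
  | ax h =>
    rcases h with rfl | (((h | h) | h) | h) | h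
    · exact hInt _ (int_weaken _ (int_rword ω hω))
    · obtain ⟨i, α, -, rfl⟩ := h
      refine hInt _ (int_weaken _ (int_weaken _ ?_))
      rw [rlist_cons _ _ (by simpa using hW i)]
      exact int_or2 _ (int_rword _ (hW i))
    · obtain ⟨i, α, -, rfl⟩ := h
      exact hInt _ (int_weaken _ (int_weaken _ (int_rword _ (hW i))))
    · obtain ⟨a, rfl⟩ := h
      exact hInt _ (int_weaken _ (int_weaken _ (int_or1 _ (int_or1 _ (int_or2 _ (int_code a))))))
    · obtain ⟨a, rfl⟩ := h
      exact hInt _ (int_weaken _ (int_weaken _ (int_or2 _ (int_or1 _ (int_code a)))))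
    · obtain ⟨α, A, -, -, hA, rfl⟩ := h
      exact Deriv.mp (Deriv.ax hA) (hInt _ (int_K _ _))

/-! Simulation of the tag system. -/

theorem sim_rotate (T : TagSystem) (ω : List (Fin T.m)) (P₀ : Finset Fm) (U : Fm)
    (γ : List (Fin T.m)) (hγ : γ ≠ []) : ∀ Y : Fm,
    Deriv (PTot T ω P₀) (tri.imp (orF (orF Y (rword γ)) U)) →
    Deriv (PTot T ω P₀) (tri.imp (orF Y (rlist (γ.map code ++ [U])))) := by
  have R2 : ∀ (a : Fin T.m) (Y Z : Fm),
      Deriv (PTot T ω P₀) (tri.imp (orF (orF Y (code a)) Z)) →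
      Deriv (PTot T ω P₀) (tri.imp (orF Y (orF (code a) Z))) := by
    intro a Y Z h
    refine h.mp ?_
    have h1 : Deriv (PTot T ω P₀) _ := Deriv.ax (Or.inr (Or.inl (Or.inr ⟨a, rfl⟩)))
    have h2 := h1.subst (fun n => if n = 0 then Fm.var 0 else if n = 1 then Y else Z)
    simpa [Fm.subst, tri_subst, orF_subst, code_subst, codeS_x0, triS_x0] using h2
  have R1 : ∀ (a : Fin T.m) (Y Z V : Fm),
      Deriv (PTot T ω P₀) (tri.imp (orF (orF Y (orF (code a) Z)) V)) →
      Deriv (PTot T ω P₀) (tri.imp (orF (orF (orF Y (code a)) Z) V)) := by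
    intro a Y Z V h
    refine h.mp ?_
    have h1 : Deriv (PTot T ω P₀) _ := Deriv.ax (Or.inr (Or.inl (Or.inl (Or.inr ⟨a, rfl⟩))))
    have h2 := h1.subst (fun n => if n = 0 then Fm.var 0 else if n = 1 then Y else
      if n = 2 then Z else V)
    simpa [Fm.subst, tri_subst, orF_subst, code_subst, codeS_x0, triS_x0] using h2
  induction γ with
  | nil => exact absurd rfl hγ
  | cons a γ ih =>
    intro Y h
    rw [List.map_cons, List.cons_append, rlist_cons _ _ (by simp)]
    cases γ with
    | nil => exact R2 a Y U h
    | cons b γ => exact R2 a Y _ (ih (by simp) (orF Y (code a)) (R1 a Y _ U h))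

theorem sim_step (T : TagSystem) (hW : ∀ i, T.W i ≠ []) (ω : List (Fin T.m))
    (P₀ : Finset Fm) {ξ ζ : List (Fin T.m)} (hs : TagStep T ξ ζ)
    (h : Deriv (PTot T ω P₀) (tri.imp (rword ξ))) :
    Deriv (PTot T ω P₀) (tri.imp (rword ζ)) := by
  obtain ⟨i, α, γ, hα, rfl, rfl⟩ := hs
  have hWc : (T.W i).map code ≠ [] := by simpa using hW i
  cases γ with
  | nil =>
    rw [List.append_nil] at h
    exact h.mp (Deriv.ax (Or.inr (Or.inl (Or.inl (Or.inl (Or.inr ⟨i, α, hα, rfl⟩))))))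
  | cons c γ =>
    have h1 : Deriv (PTot T ω P₀) _ :=
      Deriv.ax (Or.inr (Or.inl (Or.inl (Or.inl (Or.inl ⟨i, α, hα, rfl⟩)))))
    have h2 := h1.subst (fun n => if n = 0 then Fm.var 0 else rword (c :: γ))
    simp only [Fm.subst, tri_subst] at h2
    rw [rlist_subst _ _ (by simp), rlist_subst _ _ (by simp), List.map_append,
      map_code_subst, List.map_cons (f := Fm.subst _) (a := Fm.var 1) (l := List.map code (T.W i)),
      map_code_subst] at h2
    have hc : (codeS (Fm.var 0) : Fin T.m → Fm) = code := funext codeS_x0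
    simp only [if_true, hc, triS_x0, List.map_nil, List.map_cons (f := Fm.subst _),
      Fm.subst, Nat.one_ne_zero, if_false] at h2
    have e1 : rlist ((i :: α).map code ++ [rword (c :: γ)]) = rword (i :: (α ++ c :: γ)) := by
      rw [rword, rlist_append _ _ (by simp), rword]
      simp
    rw [e1, rlist_cons _ _ hWc] at h2
    have h3 := h.mp h2
    have e2 : rword (c :: γ ++ T.W i) = rlist ((c :: γ).map code ++ [rword (T.W i)]) := by
      rw [rword, rword, rlist_append _ _ hWc, List.map_append]
    rw [e2]
    cases γ with
    | nil => exact h3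
    | cons b γ => exact sim_rotate T ω P₀ _ (b :: γ) (by simp) (code c) h3

theorem steps_ne (T : TagSystem) (hW : ∀ i, T.W i ≠ []) {ω β : List (Fin T.m)}
    (hω : ω ≠ []) (h : TagSteps T ω β) : β ≠ [] := by
  cases h with
  | refl => exact hω
  | tail _ hs =>
    obtain ⟨i, α, γ, -, -, rfl⟩ := hs
    simp [hW i]

theorem sim_steps (T : TagSystem) (hW : ∀ i, T.W i ≠ []) (ω : List (Fin T.m))
    (P₀ : Finset Fm) {β : List (Fin T.m)} (hs : TagSteps T ω β) :
    Deriv (PTot T ω P₀) (tri.imp (rword β)) := by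
  induction hs with
  | refl => exact Deriv.ax (Or.inl rfl)
  | tail _ hs ih => exact sim_step T hW ω P₀ hs ih

theorem le_of_halts (T : TagSystem) (hW : ∀ i, T.W i ≠ []) (ω : List (Fin T.m)) (hω : ω ≠ [])
    (P₀ : Finset Fm) (hh : Halts T ω) {F : Fm} (hF : Deriv (↑P₀) F) :
    Deriv (PTot T ω P₀) F := by
  obtain ⟨β, hβ, hd⟩ := hh
  induction hF with
  | mp _ _ ih1 ih2 => exact ih1.mp ih2
  | subst σ _ ih => exact ih.subst σ
  | ax h =>
    exact (sim_steps T hW ω P₀ hβ).mp (Deriv.ax (Or.inr (Or.inr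
      ⟨β, _, List.length_pos_iff.2 (steps_ne T hW hω hβ), hd, h, rfl⟩)))

/-- T halts on ω iff P₀ ≤ P_{T,ω,P₀} iff P₀ and P_{T,ω,P₀} derive the same formulas. -/
theorem stmt_19 (T : TagSystem) (hW : ∀ i, T.W i ≠ []) (hd : 1 ≤ T.d)
    (ω : List (Fin T.m)) (hω : ω ≠ []) (P₀ : Finset Fm)
    (hx0 : ∀ A ∈ P₀, ¬ Occurs 0 A)
    (hInt : ∀ A : Fm, Deriv IntAx A → Deriv (↑P₀) A) :
    List.TFAE [Halts T ω,
      ∀ A : Fm, Deriv (↑P₀) A → Deriv (PTot T ω P₀) A,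
      ∀ A : Fm, Deriv (↑P₀) A ↔ Deriv (PTot T ω P₀) A] := by
  tfae_have 1 → 2 := fun h A hA => le_of_halts T hW ω hω P₀ h hA
  tfae_have 2 → 3 := fun h A => ⟨h A, PTot_le T hW ω hω P₀ hInt⟩
  tfae_have 3 → 1 := by
    intro h
    by_contra hn
    exact not_good_id T ω P₀
      (good_of_deriv T hW ω hω P₀ hn ((h _).1 (hInt _ (int_I (Fm.var 1)))))
  tfae_finish
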